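/- Let q be a prime power, 1 ≤ r ≤ min{m,n}, and let ℳ be a finite set of r-dimensional subspaces of GF(q)^m and 𝒩 a finite set of r-dimensional subspaces of GF(q)^n with |ℳ| = |𝒩| ≥ 2. Then there exists a set 𝒞 of m×n matrices over GF(q), all of rank r, with |𝒞| = |ℳ|, C(𝒞) = ℳ, and R(𝒞) = 𝒩, whose minimum rank distance d_R satisfies d_I(𝒩) + d_I(ℳ) ≤ d_R ≤ min{d_I(𝒩), d_I(ℳ)} + r. -/

import Mathlib

open Module

noncomputable def injDist {F V : Type*} [Field F] [AddCommGroup V] [Module F V]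
    (U W : Submodule F V) : ℕ :=
  finrank F ↥(U ⊔ W) - min (finrank F ↥U) (finrank F ↥W)

def rowSpace {F : Type*} [CommRing F] {m n : ℕ} (X : Matrix (Fin m) (Fin n) F) :
    Submodule F (Fin n → F) :=
  LinearMap.range X.vecMulLinear

def colSpace {F : Type*} [CommRing F] {m n : ℕ} (X : Matrix (Fin m) (Fin n) F) :
    Submodule F (Fin m → F) :=
  LinearMap.range X.mulVecLin

noncomputable def minRankDist {F : Type*} [Field F] {m n : ℕ}
    (C : Set (Matrix (Fin m) (Fin n) F)) : ℕ :=
  sInf {e | ∃ X ∈ C, ∃ Y ∈ C, X ≠ Y ∧ (X - Y).rank = e}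

noncomputable def minInjDist {F V : Type*} [Field F] [AddCommGroup V] [Module F V]
    (S : Set (Submodule F V)) : ℕ :=
  sInf {e | ∃ U ∈ S, ∃ W ∈ S, U ≠ W ∧ injDist U W = e}

/-- Maximum cardinality of a nonempty code of `m × n` matrices whose ranks all lie in `I`
and in which any two distinct codewords are at rank distance at least `d`. -/
noncomputable def maxRankCode (F : Type*) [Field F] [Fintype F] (m n d : ℕ) (I : Set ℕ) : ℕ :=
  sSup {c : ℕ | ∃ C : Set (Matrix (Fin m) (Fin n) F), C.Nonempty ∧
    (∀ X ∈ C, X.rank ∈ I) ∧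
    (∀ X ∈ C, ∀ Y ∈ C, X ≠ Y → d ≤ (X - Y).rank) ∧ C.ncard = c}

/-- `A_R(q,m,n,d,r)` : maximum cardinality of a constant-rank code of constant rank `r`
and minimum rank distance at least `d` in `GF(q)^{m × n}`. -/
noncomputable def A_R (F : Type*) [Field F] [Fintype F] (m n d r : ℕ) : ℕ :=
  maxRankCode F m n d {r}

/-- `A_C(q,n,r,d)` : maximum cardinality of a constant-dimension code of dimension `r`
and minimum injection distance at least `d` in `GF(q)^n`. -/
noncomputable def A_C (F : Type*) [Field F] [Fintype F] (n r d : ℕ) : ℕ :=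
  sSup {c : ℕ | ∃ S : Set (Submodule F (Fin n → F)), S.Nonempty ∧
    (∀ U ∈ S, finrank F ↥U = r) ∧
    (∀ U ∈ S, ∀ V ∈ S, U ≠ V → d ≤ injDist U V) ∧ S.ncard = c}

/-- `N_R(q,m,n,r)` : number of `m × n` matrices over `GF(q)` of rank `r`. -/
noncomputable def N_R (F : Type*) [Field F] [Fintype F] (m n r : ℕ) : ℕ :=
  Nat.card {X : Matrix (Fin m) (Fin n) F // X.rank = r}

/-- `α(m,s) = ∏_{i=0}^{s-1} (q^m - q^i)`. -/
def alphaq (q m s : ℕ) : ℕ := ∏ i ∈ Finset.range s, (q ^ m - q ^ i)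

/-- The Gaussian binomial `[n r]_q = α(n,r) / α(r,r)`. -/
def gaussBinom (q n r : ℕ) : ℕ := alphaq q n r / alphaq q r r

/-- `K_q = ∏_{j=1}^∞ (1 - q^{-j})`. -/
noncomputable def Kq (q : ℕ) : ℝ := ∏' j : ℕ, (1 - ((q : ℝ))⁻¹ ^ (j + 1))

/-- `M(q,m,n,d,r)` : the number of codewords of rank `r` in an `(n, n-d+1, d)` linear MRD
code over `GF(q^m)`. -/
def Mcount (q m n d r : ℕ) : ℤ :=
  (gaussBinom q n r : ℤ) *
    ∑ j ∈ Finset.Icc d r, (-1 : ℤ) ^ (r - j) * (gaussBinom q r j : ℤ) *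
      (q : ℤ) ^ ((r - j) * (r - j - 1) / 2) * ((q : ℤ) ^ (m * (j - d + 1)) - 1)

theorem finrank_colSpace' {F : Type*} [Field F] {m n : ℕ} (X : Matrix (Fin m) (Fin n) F) :
    finrank F ↥(colSpace X) = X.rank := rfl

theorem rowSpace_eq' {F : Type*} [Field F] {m n : ℕ} (X : Matrix (Fin m) (Fin n) F) :
    rowSpace X = LinearMap.range X.transpose.mulVecLin := by
  unfold rowSpace
  rw [Matrix.mulVecLin_transpose]

theorem finrank_rowSpace' {F : Type*} [Field F] {m n : ℕ} (X : Matrix (Fin m) (Fin n) F) :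
    finrank F ↥(rowSpace X) = X.rank := by
  rw [rowSpace_eq', ← Matrix.rank_transpose X]; rfl

theorem exists_basis_mat {F : Type*} [Field F] {m r : ℕ} (U : Submodule F (Fin m → F))
    (hU : finrank F ↥U = r) : ∃ A : Matrix (Fin m) (Fin r) F,
      LinearMap.range A.mulVecLin = U ∧ LinearMap.range A.transpose.mulVecLin = ⊤ := by
  let b := finBasisOfFinrankEq F U hU
  refine ⟨Matrix.of (fun i j => (b j : Fin m → F) i), ?_, ?_⟩
  · rw [Matrix.range_mulVecLin]
    have : Set.range (Matrix.of (fun i j => (b j : Fin m → F) i)).col = U.subtype '' Set.range b := by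
      rw [← Set.range_comp]; rfl
    rw [this, Submodule.span_image, b.span_eq]
    simp
  · apply Submodule.eq_top_of_finrank_eq
    change Matrix.rank _ = _
    rw [Matrix.rank_transpose]
    have : Set.range (Matrix.of (fun i j => (b j : Fin m → F) i)).col = U.subtype '' Set.range b := by
      rw [← Set.range_comp]; rfl
    unfold Matrix.rank
    rw [Matrix.range_mulVecLin, this, Submodule.span_image, b.span_eq]
    simp [hU]

theorem exists_mat {F : Type*} [Field F] {m n r : ℕ} (U : Submodule F (Fin m → F))
    (V : Submodule F (Fin n → F)) (hU : finrank F ↥U = r) (hV : finrank F ↥V = r) :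
    ∃ X : Matrix (Fin m) (Fin n) F, colSpace X = U ∧ rowSpace X = V := by
  obtain ⟨A, hA, hA'⟩ := exists_basis_mat U hU
  obtain ⟨B, hB, hB'⟩ := exists_basis_mat V hV
  refine ⟨A * B.transpose, ?_, ?_⟩
  · unfold colSpace
    rw [Matrix.mulVecLin_mul, LinearMap.range_comp, hB', Submodule.map_top, hA]
  · rw [rowSpace_eq', Matrix.transpose_mul, Matrix.transpose_transpose,
      Matrix.mulVecLin_mul, LinearMap.range_comp, hA', Submodule.map_top, hB]

theorem finrank_ker_inf {F : Type*} [Field F] {m n : ℕ} (X Y : Matrix (Fin m) (Fin n) F) :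
    finrank F ↥(LinearMap.ker X.mulVecLin ⊓ LinearMap.ker Y.mulVecLin) +
      finrank F ↥(rowSpace X ⊔ rowSpace Y) = n := by
  have h1 : LinearMap.ker (Matrix.fromRows X Y).mulVecLin =
      LinearMap.ker X.mulVecLin ⊓ LinearMap.ker Y.mulVecLin := by
    ext v
    simp only [LinearMap.mem_ker, Submodule.mem_inf, Matrix.mulVecLin_apply, Matrix.fromRows_mulVec]
    constructor
    · intro h
      exact ⟨funext fun i => congrFun h (Sum.inl i), funext fun i => congrFun h (Sum.inr i)⟩
    · rintro ⟨h, h'⟩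
      rw [h, h']
      ext i; cases i <;> rfl
  have h2 : rowSpace X ⊔ rowSpace Y = LinearMap.range (Matrix.fromRows X Y).transpose.mulVecLin := by
    rw [rowSpace_eq', rowSpace_eq']
    simp only [Matrix.range_mulVecLin]
    rw [← Submodule.span_union]
    congr 1
    ext v
    simp only [Set.mem_union, Set.mem_range]
    constructor
    · rintro (⟨i, rfl⟩ | ⟨i, rfl⟩)
      · exact ⟨Sum.inl i, rfl⟩
      · exact ⟨Sum.inr i, rfl⟩
    · rintro ⟨i | i, rfl⟩
      · exact Or.inl ⟨i, rfl⟩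
      · exact Or.inr ⟨i, rfl⟩
  have h3 : finrank F ↥(LinearMap.range (Matrix.fromRows X Y).transpose.mulVecLin) =
      finrank F ↥(LinearMap.range (Matrix.fromRows X Y).mulVecLin) :=
    Matrix.rank_transpose (Matrix.fromRows X Y)
  rw [← h1, h2, h3, add_comm, LinearMap.finrank_range_add_finrank_ker]
  simp

theorem lower {F : Type*} [Field F] {m n : ℕ} (X Y : Matrix (Fin m) (Fin n) F) :
    finrank F ↥(colSpace X ⊔ colSpace Y) + finrank F ↥(rowSpace X ⊔ rowSpace Y) ≤
      (X - Y).rank + X.rank + Y.rank := by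
  have hk := finrank_ker_inf X Y
  have hX : X.rank + finrank F ↥(LinearMap.ker X.mulVecLin) = n := by
    have := LinearMap.finrank_range_add_finrank_ker X.mulVecLin
    rw [Module.finrank_fin_fun] at this
    exact this
  have h1 : colSpace X ⊔ colSpace Y ≤ colSpace (X - Y) ⊔ colSpace Y := by
    refine sup_le ?_ le_sup_right
    rintro _ ⟨v, rfl⟩
    refine Submodule.mem_sup.2 ⟨_, ⟨v, rfl⟩, _, ⟨v, rfl⟩, ?_⟩
    simp [Matrix.sub_mulVec]
  have h1' := Submodule.finrank_mono h1
  have h2 := Submodule.finrank_sup_add_finrank_inf_eq (colSpace (X - Y)) (colSpace Y)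
  rw [finrank_colSpace', finrank_colSpace'] at h2
  have h3 : (LinearMap.ker X.mulVecLin).map Y.mulVecLin ≤ colSpace (X - Y) ⊓ colSpace Y := by
    rintro _ ⟨v, hv, rfl⟩
    have hv' : X.mulVec v = 0 := hv
    refine ⟨⟨-v, ?_⟩, ⟨v, rfl⟩⟩
    simp [Matrix.sub_mulVec, Matrix.mulVec_neg, hv']
  have h3' := Submodule.finrank_mono h3
  have h4 := LinearMap.finrank_range_add_finrank_ker
    (Y.mulVecLin.domRestrict (LinearMap.ker X.mulVecLin))
  rw [LinearMap.range_domRestrict] at h4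
  have h5 : finrank F ↥(LinearMap.ker (Y.mulVecLin.domRestrict (LinearMap.ker X.mulVecLin))) =
      finrank F ↥(LinearMap.ker X.mulVecLin ⊓ LinearMap.ker Y.mulVecLin) := by
    rw [LinearMap.ker_domRestrict, ← Submodule.map_comap_subtype]
    exact (LinearEquiv.finrank_eq
      (Submodule.equivMapOfInjective _ (Submodule.injective_subtype _) _))
  omega

theorem upper_col {F : Type*} [Field F] {m n : ℕ} (X Y : Matrix (Fin m) (Fin n) F) :
    (X - Y).rank ≤ finrank F ↥(colSpace X ⊔ colSpace Y) := by
  rw [← finrank_colSpace']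
  apply Submodule.finrank_mono
  rintro _ ⟨v, rfl⟩
  have : (X - Y).mulVecLin v = X.mulVecLin v - Y.mulVecLin v := by simp [Matrix.sub_mulVec]
  rw [this]
  exact Submodule.sub_mem _ (Submodule.mem_sup_left ⟨v, rfl⟩) (Submodule.mem_sup_right ⟨v, rfl⟩)

theorem upper_row {F : Type*} [Field F] {m n : ℕ} (X Y : Matrix (Fin m) (Fin n) F) :
    (X - Y).rank ≤ finrank F ↥(rowSpace X ⊔ rowSpace Y) := by
  have := upper_col X.transpose Y.transpose
  rw [← Matrix.transpose_sub, Matrix.rank_transpose] at this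
  rw [rowSpace_eq', rowSpace_eq']
  exact this

theorem minInj_mem {F V : Type*} [Field F] [AddCommGroup V] [Module F V]
    (S : Set (Submodule F V)) (h : 2 ≤ S.ncard) :
    ∃ U ∈ S, ∃ W ∈ S, U ≠ W ∧ injDist U W = minInjDist S := by
  have hfin : S.Finite := Set.finite_of_ncard_pos (by omega)
  obtain ⟨a, ha, b, hb, hab⟩ := (Set.one_lt_ncard hfin).1 (by omega : 1 < S.ncard)
  exact Nat.sInf_mem (s := {e | ∃ U ∈ S, ∃ W ∈ S, U ≠ W ∧ injDist U W = e})
    ⟨_, a, ha, b, hb, hab, rfl⟩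

theorem stmt3 {q m n r : ℕ} (F : Type*) [Field F] [Fintype F] (hF : Fintype.card F = q)
    (hr1 : 1 ≤ r) (hrm : r ≤ m) (hrn : r ≤ n)
    (M : Set (Submodule F (Fin m → F))) (N : Set (Submodule F (Fin n → F)))
    (hMdim : ∀ U ∈ M, finrank F ↥U = r) (hNdim : ∀ V ∈ N, finrank F ↥V = r)
    (hMfin : M.Finite) (hNfin : N.Finite)
    (hcard : M.ncard = N.ncard) (htwo : 2 ≤ M.ncard) :
    ∃ C : Set (Matrix (Fin m) (Fin n) F),
      (∀ X ∈ C, X.rank = r) ∧ C.ncard = M.ncard ∧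
      colSpace '' C = M ∧ rowSpace '' C = N ∧
      minInjDist N + minInjDist M ≤ minRankDist C ∧
      minRankDist C ≤ min (minInjDist N) (minInjDist M) + r := by
  have _ := hF
  obtain ⟨e⟩ : Nonempty (M ≃ N) := by
    have := hMfin.to_subtype
    have := hNfin.to_subtype
    exact Finite.card_eq.1 hcard
  choose f hfc hfr using fun U : M => exists_mat U.1 (e U).1 (hMdim _ U.2) (hNdim _ (e U).2)
  have hfi : Function.Injective f := fun U W h => by
    apply Subtype.ext
    rw [← hfc U, ← hfc W, h]
  have hrk : ∀ U, (f U).rank = r := fun U => by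
    rw [← finrank_colSpace', hfc, hMdim _ U.2]
  obtain ⟨A, hA, B, hB, hAB, hABd⟩ := minInj_mem M htwo
  obtain ⟨A', hA', B', hB', hAB', hABd'⟩ := minInj_mem N (hcard ▸ htwo)
  refine ⟨Set.range f, ?_, ?_, ?_, ?_, ?_, ?_⟩
  · rintro _ ⟨U, rfl⟩
    exact hrk U
  · rw [← Set.image_univ, Set.ncard_image_of_injective _ hfi, Set.ncard_univ]
    rfl
  · rw [← Set.range_comp]
    have : colSpace ∘ f = Subtype.val := funext hfc
    rw [this, Subtype.range_val]
  · rw [← Set.range_comp]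
    have : rowSpace ∘ f = Subtype.val ∘ e := funext hfr
    rw [this, Set.range_comp, e.range_eq_univ, Set.image_univ, Subtype.range_val]
  · refine le_csInf ⟨_, f ⟨A, hA⟩, ⟨_, rfl⟩, f ⟨B, hB⟩, ⟨_, rfl⟩, fun h => hAB ?_, rfl⟩ ?_
    · exact congrArg Subtype.val (hfi h)
    · rintro _ ⟨_, ⟨U, rfl⟩, _, ⟨W, rfl⟩, hne, rfl⟩
      have hUW : U ≠ W := fun h => hne (by rw [h])
      have h1 : minInjDist M ≤ injDist U.1 W.1 :=
        Nat.sInf_le ⟨_, U.2, _, W.2, fun h => hUW (Subtype.ext h), rfl⟩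
      have h2 : minInjDist N ≤ injDist (e U).1 (e W).1 :=
        Nat.sInf_le ⟨_, (e U).2, _, (e W).2, fun h => hUW (e.injective (Subtype.ext h)), rfl⟩
      have h3 := lower (f U) (f W)
      rw [hrk, hrk, hfc, hfc, hfr, hfr] at h3
      have h4 := Submodule.finrank_mono (le_sup_left : U.1 ≤ U.1 ⊔ W.1)
      have h5 := Submodule.finrank_mono (le_sup_left : (e U).1 ≤ (e U).1 ⊔ (e W).1)
      unfold injDist at h1 h2
      rw [hMdim _ U.2] at h1 h4
      rw [hMdim _ W.2] at h1
      rw [hNdim _ (e U).2] at h2 h5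
      rw [hNdim _ (e W).2] at h2
      rw [min_self] at h1 h2
      omega
  · have key1 : minRankDist (Set.range f) ≤ minInjDist M + r := by
      have h1 : minRankDist (Set.range f) ≤ (f ⟨A, hA⟩ - f ⟨B, hB⟩).rank :=
        Nat.sInf_le ⟨_, ⟨_, rfl⟩, _, ⟨_, rfl⟩,
          fun h => hAB (congrArg Subtype.val (hfi h)), rfl⟩
      have h2 := upper_col (f ⟨A, hA⟩) (f ⟨B, hB⟩)
      rw [hfc, hfc] at h2
      rw [← hABd]
      unfold injDist
      rw [hMdim _ hA, hMdim _ hB, min_self]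
      dsimp only at h2
      omega
    have key2 : minRankDist (Set.range f) ≤ minInjDist N + r := by
      have h1 : minRankDist (Set.range f) ≤ (f (e.symm ⟨A', hA'⟩) - f (e.symm ⟨B', hB'⟩)).rank :=
        Nat.sInf_le ⟨_, ⟨_, rfl⟩, _, ⟨_, rfl⟩,
          fun h => hAB' (congrArg Subtype.val (e.symm.injective (hfi h))), rfl⟩
      have h2 := upper_row (f (e.symm ⟨A', hA'⟩)) (f (e.symm ⟨B', hB'⟩))
      rw [hfr, hfr, e.apply_symm_apply, e.apply_symm_apply] at h2
      rw [← hABd']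
      unfold injDist
      rw [hNdim _ hA', hNdim _ hB', min_self]
      dsimp only at h2
      omega
    omega
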